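/- Let G be a Kw game and B_G its associated Boolean game. Then NE(B_G) ≠ ∅ if and only if NE_max(G) ≠ ∅ (the Boolean game has a Nash equilibrium iff the Kw game has a maximal Nash equilibrium). -/

import Mathlib

open Classical

/-! ## Basic setting: players, variables, strategies, observation relations -/

/-- A strategy for player `i`: it assigns to each player `j` the set of variables
(all observed/owned by `i`) that `i` reveals to `j`, where `i` "reveals" all of its
own variables to itself. -/
structure Strategy {ι P : Type} (owner : P → ι) (i : ι) where
  reveal : ι → Set P
  reveal_subset : ∀ j, reveal j ⊆ {p | owner p = i}
  reveal_self : reveal i = {p | owner p = i}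

/-- A strategy profile: one strategy per player. -/
abbrev Profile {ι P : Type} (owner : P → ι) : Type := ∀ i, Strategy owner i

/-- `P_i(s)`: the set of variables revealed to player `i` in profile `s`. -/
def revealedTo {ι P : Type} (owner : P → ι) (s : Profile owner) (i : ι) : Set P :=
  {p | ∃ j, p ∈ (s j).reveal i}

/-- The observation relation `v ∼_i^s w`. -/
def obsRel {ι P : Type} (owner : P → ι) (s : Profile owner) (i : ι) (v w : Set P) : Prop :=
  v ∩ revealedTo owner s i = w ∩ revealedTo owner s i

/-- The initial observation relation `v ∼_i w`. -/
def obsInit {ι P : Type} (owner : P → ι) (i : ι) (v w : Set P) : Prop :=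
  v ∩ {p | owner p = i} = w ∩ {p | owner p = i}

/-! ## The epistemic language `L^K` and its semantics -/

/-- The epistemic language `L^K`: atoms, negation, disjunction, knowledge. -/
inductive Form (ι P : Type) : Type where
  | atom : P → Form ι P
  | neg : Form ι P → Form ι P
  | or : Form ι P → Form ι P → Form ι P
  | know : ι → Form ι P → Form ι P

/-- Conjunction, defined by abbreviation. -/
def Form.and {ι P : Type} (α β : Form ι P) : Form ι P := .neg (.or (.neg α) (.neg β))

/-- `K̂_i α := ¬ K_i ¬ α`. -/
def Form.hatK {ι P : Type} (i : ι) (α : Form ι P) : Form ι P := .neg (.know i (.neg α))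

/-- `Kw_i α := K_i α ∨ K_i ¬ α`. -/
def Form.Kw {ι P : Type} (i : ι) (α : Form ι P) : Form ι P :=
  .or (.know i α) (.know i (.neg α))

/-- Satisfaction `v,s ⊨ α`. -/
def sat {ι P : Type} (owner : P → ι) : Set P → Profile owner → Form ι P → Prop
  | v, _, .atom p => p ∈ v
  | v, s, .neg α => ¬ sat owner v s α
  | v, s, .or α β => sat owner v s α ∨ sat owner v s β
  | v, s, .know i α => ∀ w, obsRel owner s i v w → sat owner w s α

/-- The fragment `L^Kw` of knowing-whether formulas (as a subset of `L^K`). -/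
inductive IsKw {ι P : Type} : Form ι P → Prop
  | kw (j : ι) (p : P) : IsKw (Form.Kw j (.atom p))
  | neg {α : Form ι P} : IsKw α → IsKw (.neg α)
  | or {α β : Form ι P} : IsKw α → IsKw β → IsKw (.or α β)

/-- The fragment `L^K_nnf` of formulas in negation normal form. -/
inductive IsNNF {ι P : Type} : Form ι P → Prop
  | atom (p : P) : IsNNF (.atom p)
  | natom (p : P) : IsNNF (.neg (.atom p))
  | and {α β : Form ι P} : IsNNF α → IsNNF β → IsNNF (Form.and α β)
  | or {α β : Form ι P} : IsNNF α → IsNNF β → IsNNF (.or α β)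
  | know {α : Form ι P} (i : ι) : IsNNF α → IsNNF (.know i α)
  | hatK {α : Form ι P} (i : ι) : IsNNF α → IsNNF (Form.hatK i α)

/-- The fragment `L^Kw_nnf`. -/
inductive IsKwNNF {ι P : Type} : Form ι P → Prop
  | kw (j : ι) (p : P) : IsKwNNF (Form.Kw j (.atom p))
  | nkw (j : ι) (p : P) : IsKwNNF (.neg (Form.Kw j (.atom p)))
  | or {α β : Form ι P} : IsKwNNF α → IsKwNNF β → IsKwNNF (.or α β)
  | and {α β : Form ι P} : IsKwNNF α → IsKwNNF β → IsKwNNF (Form.and α β)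

/-! ## Uniform strategies, expected outcomes, Nash equilibria -/

/-- A uniform strategy profile assigns to each player a map from valuations to strategies. -/
abbrev UProfile {ι P : Type} (owner : P → ι) : Type := ∀ i, Set P → Strategy owner i

/-- Uniformity: the same strategy on indistinguishable valuations. -/
def IsUniform {ι P : Type} (owner : P → ι) (i : ι) (f : Set P → Strategy owner i) : Prop :=
  ∀ v w, obsInit owner i v w → f v = f w

/-- Global uniformity: the same strategy on all valuations. -/
def IsGUniform {ι P : Type} (owner : P → ι) (i : ι) (f : Set P → Strategy owner i) : Prop :=
  ∀ v w, f v = f w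

/-- The strategy profile `us(v)` determined by a uniform strategy profile at valuation `v`. -/
def applyU {ι P : Type} (owner : P → ι) (us : UProfile owner) (v : Set P) : Profile owner :=
  fun i => us i v

/-- The outcome `u_i(v,s)`: `1` if player `i`'s goal (described by `win`) holds, else `0`. -/
noncomputable def outcome {ι P : Type} (owner : P → ι)
    (win : ι → Set P → Profile owner → Prop) (i : ι) (v : Set P) (s : Profile owner) : ℕ :=
  if win i v s then 1 else 0

/-- Nash equilibrium of the pointed game `G(v)`. -/
def pointedNE {ι P : Type} [DecidableEq ι] (owner : P → ι)
    (win : ι → Set P → Profile owner → Prop) (v : Set P) (s : Profile owner) : Prop :=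
  ∀ (i : ι) (s' : Strategy owner i),
    outcome owner win i v s ≥ outcome owner win i v (Function.update s i s')

/-- `min 𝐮_i(v,us)`: the minimum of the expected outcome of player `i` over its
information set (a vector of `0`s and `1`s). -/
noncomputable def pessVal {ι P : Type} (owner : P → ι)
    (win : ι → Set P → Profile owner → Prop) (i : ι) (v : Set P) (us : UProfile owner) : ℕ :=
  if ∀ w, obsInit owner i v w → outcome owner win i w (applyU owner us w) = 1 then 1 else 0

/-- `max 𝐮_i(v,us)`: the maximum of the expected outcome of player `i` over its
information set. -/
noncomputable def optVal {ι P : Type} (owner : P → ι)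
    (win : ι → Set P → Profile owner → Prop) (i : ι) (v : Set P) (us : UProfile owner) : ℕ :=
  if ∃ w, obsInit owner i v w ∧ outcome owner win i w (applyU owner us w) = 1 then 1 else 0

/-- The maximal outcome relation `𝐮_i(v,us) >^max 𝐮_i(v,us')`. -/
def maxGt {ι P : Type} (owner : P → ι) (win : ι → Set P → Profile owner → Prop)
    (i : ι) (v : Set P) (us us' : UProfile owner) : Prop :=
  ∃ w, obsInit owner i v w ∧
    outcome owner win i w (applyU owner us w) > outcome owner win i w (applyU owner us' w)

/-- Maximal Nash equilibrium: a uniform strategy profile from which no player has a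
profitable deviation w.r.t. the maximal outcome relation. -/
def NEmax {ι P : Type} [DecidableEq ι] (owner : P → ι)
    (win : ι → Set P → Profile owner → Prop) (us : UProfile owner) : Prop :=
  (∀ i, IsUniform owner i (us i)) ∧
  ∀ (i : ι) (f : Set P → Strategy owner i), IsUniform owner i f →
    ∀ v, ¬ maxGt owner win i v (Function.update us i f) us

/-- Pessimist Nash equilibrium. -/
def NEpess {ι P : Type} [DecidableEq ι] (owner : P → ι)
    (win : ι → Set P → Profile owner → Prop) (us : UProfile owner) : Prop :=
  (∀ i, IsUniform owner i (us i)) ∧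
  ∀ (i : ι) (f : Set P → Strategy owner i), IsUniform owner i f →
    ∀ v, ¬ (pessVal owner win i v (Function.update us i f) > pessVal owner win i v us)

/-- Optimist Nash equilibrium. -/
def NEopt {ι P : Type} [DecidableEq ι] (owner : P → ι)
    (win : ι → Set P → Profile owner → Prop) (us : UProfile owner) : Prop :=
  (∀ i, IsUniform owner i (us i)) ∧
  ∀ (i : ι) (f : Set P → Strategy owner i), IsUniform owner i f →
    ∀ v, ¬ (optVal owner win i v (Function.update us i f) > optVal owner win i v us)

/-! ## Boolean formulas and knowing-whether formulas -/

/-- Boolean formulas `L^B` over a set of variables. -/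
inductive BForm (P : Type) : Type where
  | atom : P → BForm P
  | neg : BForm P → BForm P
  | or : BForm P → BForm P → BForm P

/-- Classical propositional satisfaction of Boolean formulas. -/
def bsat {P : Type} (v : Set P) : BForm P → Prop
  | .atom p => p ∈ v
  | .neg α => ¬ bsat v α
  | .or α β => bsat v α ∨ bsat v β

/-- The language `L^Kw` of knowing-whether formulas (as a language of its own). -/
inductive KwForm (ι P : Type) : Type where
  | kw : ι → P → KwForm ι P
  | neg : KwForm ι P → KwForm ι P
  | or : KwForm ι P → KwForm ι P → KwForm ι P

/-- `Kw_j p` holds at `(v,s)`: player `j` knows whether `p`. -/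
def kwHolds {ι P : Type} (owner : P → ι) (v : Set P) (s : Profile owner)
    (j : ι) (p : P) : Prop :=
  (∀ w, obsRel owner s j v w → p ∈ w) ∨ (∀ w, obsRel owner s j v w → p ∉ w)

/-- Epistemic satisfaction of knowing-whether formulas. -/
def ksat {ι P : Type} (owner : P → ι) : Set P → Profile owner → KwForm ι P → Prop
  | v, s, .kw j p => kwHolds owner v s j p
  | v, s, .neg α => ¬ ksat owner v s α
  | v, s, .or α β => ksat owner v s α ∨ ksat owner v s β

/-! ## From Boolean games to Kw games -/

/-- The translation `λ : L^B → L^Kw`, mapping `p_i` to `Kw_{i⁺} p_i` where `i⁺` is the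
(cyclic) successor of `i`. -/
def lam {P : Type} {n : ℕ} [NeZero n] (owner : P → Fin n) : BForm P → KwForm (Fin n) P
  | .atom p => .kw (owner p + 1) p
  | .neg α => .neg (lam owner α)
  | .or α β => .or (lam owner α) (lam owner β)

/-- The strategy profile `s^w` associated with a valuation `w`: each player `i` reveals
(to its cyclic successor `i⁺`, and no one else) exactly its variables that are in `w`. -/
def profOf {P : Type} {n : ℕ} [NeZero n] (owner : P → Fin n) (w : Set P) :
    Profile owner := fun i =>
  { reveal := fun j =>
      if j = i then {p | owner p = i}
      else if j = i + 1 then {p | owner p = i ∧ p ∈ w}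
      else ∅
    reveal_subset := by
      intro j
      by_cases h1 : j = i
      · rw [if_pos h1]
      · rw [if_neg h1]
        by_cases h2 : j = i + 1
        · rw [if_pos h2]; exact fun p hp => hp.1
        · rw [if_neg h2]; exact fun p hp => absurd hp (Set.notMem_empty p)
    reveal_self := by rw [if_pos rfl] }

/-- Outcome function of a Boolean game. -/
noncomputable def bOutcome {ι P : Type} (owner : P → ι) (γ : ι → BForm P)
    (i : ι) (v : Set P) : ℕ :=
  if bsat v (γ i) then 1 else 0

/-- The valuation `(v'_i, v_{-i})` resulting from player `i` deviating, in a Boolean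
game, to the local valuation `vi` (only the part of `vi` inside `P_i` matters). -/
def bDeviate {ι P : Type} (owner : P → ι) (v : Set P) (i : ι) (vi : Set P) : Set P :=
  {p | if owner p = i then p ∈ vi else p ∈ v}

/-- Nash equilibrium of a Boolean game. -/
def BNE {ι P : Type} (owner : P → ι) (γ : ι → BForm P) (v : Set P) : Prop :=
  ∀ (i : ι) (vi : Set P), bOutcome owner γ i v ≥ bOutcome owner γ i (bDeviate owner v i vi)

/-! ## Globally uniform strategy profiles, the equivalence `≡`, and `χ` -/

/-- The set `𝐒^g` of globally uniform strategy profiles. -/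
def GProfile {ι P : Type} (owner : P → ι) : Type :=
  {us : UProfile owner // ∀ i, IsGUniform owner i (us i)}

/-- The equivalence `ṡ ≡ ṫ iff s_i(i⁺) = t_i(i⁺) for all i` on globally uniform
strategy profiles. -/
def gSetoid {P : Type} {n : ℕ} [NeZero n] (owner : P → Fin n) :
    Setoid (GProfile owner) where
  r us ut := ∀ i, (us.1 i ∅).reveal (i + 1) = (ut.1 i ∅).reveal (i + 1)
  iseqv := ⟨fun _ _ => rfl, fun h i => (h i).symm, fun h h' i => (h i).trans (h' i)⟩

/-- The map `χ : V → 𝐒^g/≡`, `χ(v) = [ṡ^v]`. -/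
def chi {P : Type} {n : ℕ} [NeZero n] (owner : P → Fin n) (w : Set P) :
    Quotient (gSetoid owner) :=
  Quotient.mk (gSetoid owner) ⟨fun i _ => profOf owner w i, fun _ _ _ => rfl⟩

/-! ## From Kw games to Boolean games -/

/-- The set `Q` of variables of the Boolean game associated with a Kw game:
pairs `(j,p)` standing for the atom `Kw_j p` with `j ≠ owner p`. -/
def QVar {ι P : Type} (owner : P → ι) : Type := {q : ι × P // q.1 ≠ owner q.2}

/-- Classical propositional satisfaction of knowing-whether formulas read as Boolean
formulas over the atoms `Q`. -/
def kbsat {ι P : Type} (owner : P → ι) (w : Set (QVar owner)) : KwForm ι P → Prop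
  | .kw j p => ∃ h : j ≠ owner p, (⟨(j, p), h⟩ : QVar owner) ∈ w
  | .neg α => ¬ kbsat owner w α
  | .or α β => kbsat owner w α ∨ kbsat owner w β

/-- A knowing-whether formula contains no trivial constituent `Kw_i p_i`. -/
inductive NoTrivial {ι P : Type} (owner : P → ι) : KwForm ι P → Prop
  | kw {j : ι} {p : P} : j ≠ owner p → NoTrivial owner (.kw j p)
  | neg {α : KwForm ι P} : NoTrivial owner α → NoTrivial owner (.neg α)
  | or {α β : KwForm ι P} :
      NoTrivial owner α → NoTrivial owner β → NoTrivial owner (.or α β)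

/-- The map `η` on strategy profiles: `Kw_j p ∈ η(ṡ)` iff `p ∈ s_{owner p}(j)`. -/
def etaP {ι P : Type} (owner : P → ι) (s : Profile owner) : Set (QVar owner) :=
  {q | q.1.2 ∈ (s (owner q.1.2)).reveal q.1.1}

/-- The map `η : 𝐒^g → W` on globally uniform strategy profiles. -/
def etaG {ι P : Type} (owner : P → ι) (us : GProfile owner) : Set (QVar owner) :=
  etaP owner (fun i => us.1 i ∅)

/-- Outcome of the associated Boolean game `B_G` (variables `Q`, goals read as Boolean
formulas over `Q`). -/
noncomputable def ubq {ι P : Type} (owner : P → ι) (γ : ι → KwForm ι P)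
    (i : ι) (w : Set (QVar owner)) : ℕ :=
  if kbsat owner w (γ i) then 1 else 0

/-- Deviation by player `i` in `B_G` (player `i` controls `Q_i = {Kw_j p | owner p = i}`). -/
def bDeviateQ {ι P : Type} (owner : P → ι) (w : Set (QVar owner)) (i : ι)
    (wi : Set (QVar owner)) : Set (QVar owner) :=
  {q | if owner q.1.2 = i then q ∈ wi else q ∈ w}

/-- Nash equilibrium of the Boolean game `B_G`. -/
def BNEQ {ι P : Type} (owner : P → ι) (γ : ι → KwForm ι P) (w : Set (QVar owner)) : Prop :=
  ∀ (i : ι) (wi : Set (QVar owner)), ubq owner γ i w ≥ ubq owner γ i (bDeviateQ owner w i wi)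

/-! ## Negation normal form languages as languages of their own -/

/-- The language `L^K_nnf` in negation normal form, as a language of its own. -/
inductive NForm (ι P : Type) : Type where
  | atom : P → NForm ι P
  | natom : P → NForm ι P
  | and : NForm ι P → NForm ι P → NForm ι P
  | or : NForm ι P → NForm ι P → NForm ι P
  | know : ι → NForm ι P → NForm ι P
  | hatK : ι → NForm ι P → NForm ι P

/-- Satisfaction for `NForm`. -/
def nsat {ι P : Type} (owner : P → ι) : Set P → Profile owner → NForm ι P → Prop
  | v, _, .atom p => p ∈ v
  | v, _, .natom p => p ∉ v
  | v, s, .and α β => nsat owner v s α ∧ nsat owner v s β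
  | v, s, .or α β => nsat owner v s α ∨ nsat owner v s β
  | v, s, .know i α => ∀ w, obsRel owner s i v w → nsat owner w s α
  | v, s, .hatK i α => ∃ w, obsRel owner s i v w ∧ nsat owner w s α

/-- The positive fragment `L^+` (no `K̂` modalities). -/
inductive IsPositive {ι P : Type} : NForm ι P → Prop
  | atom (p : P) : IsPositive (.atom p)
  | natom (p : P) : IsPositive (.natom p)
  | and {α β : NForm ι P} : IsPositive α → IsPositive β → IsPositive (.and α β)
  | or {α β : NForm ι P} : IsPositive α → IsPositive β → IsPositive (.or α β)
  | know {α : NForm ι P} (i : ι) : IsPositive α → IsPositive (.know i α)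

/-- The self-positive fragment `L^{j+}`: all occurrences of `K_j` are positive. -/
inductive SelfPos {ι P : Type} (j : ι) : NForm ι P → Prop
  | atom (p : P) : SelfPos j (.atom p)
  | natom (p : P) : SelfPos j (.natom p)
  | and {α β : NForm ι P} : SelfPos j α → SelfPos j β → SelfPos j (.and α β)
  | or {α β : NForm ι P} : SelfPos j α → SelfPos j β → SelfPos j (.or α β)
  | know {α : NForm ι P} (k : ι) : SelfPos j α → SelfPos j (.know k α)
  | hatK {α : NForm ι P} {k : ι} : k ≠ j → SelfPos j α → SelfPos j (.hatK k α)

/-- `pol owner j φ = (+^j(φ), −^j(φ))`: positive / negative epistemic assertions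
about variables of player `j` in the NNF formula `φ`. -/
def pol {ι P : Type} (owner : P → ι) (j : ι) : NForm ι P → Prop × Prop
  | .atom p => (owner p = j, False)
  | .natom p => (owner p = j, False)
  | .and α β => ((pol owner j α).1 ∨ (pol owner j β).1, (pol owner j α).2 ∨ (pol owner j β).2)
  | .or α β => ((pol owner j α).1 ∨ (pol owner j β).1, (pol owner j α).2 ∨ (pol owner j β).2)
  | .know _ α => pol owner j α
  | .hatK _ α => ((pol owner j α).2, (pol owner j α).1)

/-- `|type(i)|`: the number of elements of `type(i) ⊆ {+, −, c+, c−}`. -/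
noncomputable def typeCard {ι P : Type} (owner : P → ι) (γ : ι → NForm ι P) (i : ι) : ℕ :=
  (if ∃ j, j ≠ i ∧ (pol owner j (γ i)).1 then 1 else 0) +
  (if ∃ j, j ≠ i ∧ (pol owner j (γ i)).2 then 1 else 0) +
  (if (pol owner i (γ i)).1 then 1 else 0) +
  (if (pol owner i (γ i)).2 then 1 else 0)

/-- The language `L^Kw_nnf` as a language of its own. -/
inductive KwNForm (ι P : Type) : Type where
  | kw : ι → P → KwNForm ι P
  | nkw : ι → P → KwNForm ι P
  | and : KwNForm ι P → KwNForm ι P → KwNForm ι P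
  | or : KwNForm ι P → KwNForm ι P → KwNForm ι P

/-- Satisfaction for `KwNForm`. -/
def knsat {ι P : Type} (owner : P → ι) : Set P → Profile owner → KwNForm ι P → Prop
  | v, s, .kw j p => kwHolds owner v s j p
  | v, s, .nkw j p => ¬ kwHolds owner v s j p
  | v, s, .and α β => knsat owner v s α ∧ knsat owner v s β
  | v, s, .or α β => knsat owner v s α ∨ knsat owner v s β

/-- Polarity for `KwNForm`. -/
def kpol {ι P : Type} (owner : P → ι) (j : ι) : KwNForm ι P → Prop × Prop
  | .kw _ p => (owner p = j, False)
  | .nkw _ p => (False, owner p = j)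
  | .and α β =>
      ((kpol owner j α).1 ∨ (kpol owner j β).1, (kpol owner j α).2 ∨ (kpol owner j β).2)
  | .or α β =>
      ((kpol owner j α).1 ∨ (kpol owner j β).1, (kpol owner j α).2 ∨ (kpol owner j β).2)

/-- `|type(i)|` for Kw games. -/
noncomputable def ktypeCard {ι P : Type} (owner : P → ι) (γ : ι → KwNForm ι P) (i : ι) : ℕ :=
  (if ∃ j, j ≠ i ∧ (kpol owner j (γ i)).1 then 1 else 0) +
  (if ∃ j, j ≠ i ∧ (kpol owner j (γ i)).2 then 1 else 0) +
  (if (kpol owner i (γ i)).1 then 1 else 0) +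
  (if (kpol owner i (γ i)).2 then 1 else 0)

/-- The strategy profile `s^∀` in which everybody reveals everything to everyone. -/
def allProf {ι P : Type} (owner : P → ι) : Profile owner := fun i =>
  { reveal := fun _ => {p | owner p = i}
    reveal_subset := fun _ _ hp => hp
    reveal_self := rfl }

theorem mem_revealedTo_iff {ι P : Type} (owner : P → ι) (s : Profile owner) (j : ι) (p : P) :
    p ∈ revealedTo owner s j ↔ p ∈ (s (owner p)).reveal j := by
  constructor
  · rintro ⟨k, hk⟩
    have h : owner p = k := (s k).reveal_subset j hk
    subst h
    exact hk
  · intro h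
    exact ⟨_, h⟩

theorem kwHolds_iff {ι P : Type} (owner : P → ι) (v : Set P) (s : Profile owner)
    (j : ι) (p : P) : kwHolds owner v s j p ↔ p ∈ (s (owner p)).reveal j := by
  rw [← mem_revealedTo_iff]
  constructor
  · intro h
    by_contra hp
    have e1 : obsRel owner s j v (v ∪ {p}) := by
      ext q
      by_cases hq : q = p
      · subst hq; simp [hp]
      · simp [hq]
    have e2 : obsRel owner s j v (v \ {p}) := by
      ext q
      by_cases hq : q = p
      · subst hq; simp [hp]
      · simp [hq]
    rcases h with h | h
    · exact (h _ e2).2 rfl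
    · exact h _ e1 (Or.inr rfl)
  · intro hp
    have key : ∀ w, obsRel owner s j v w → (p ∈ v ↔ p ∈ w) := by
      intro w hw
      have := Set.ext_iff.mp hw p
      simpa [hp] using this
    by_cases hv : p ∈ v
    · exact Or.inl fun w hw => (key w hw).1 hv
    · exact Or.inr fun w hw h => hv ((key w hw).2 h)

theorem ksat_iff_kbsat {ι P : Type} (owner : P → ι) (v : Set P) (s : Profile owner)
    (α : KwForm ι P) (h : NoTrivial owner α) :
    ksat owner v s α ↔ kbsat owner (etaP owner s) α := by
  induction h with
  | kw hj =>
    simp only [ksat, kbsat, kwHolds_iff]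
    exact ⟨fun h => ⟨hj, h⟩, fun ⟨_, h⟩ => h⟩
  | neg _ ih => simp only [ksat, kbsat, ih]
  | or _ _ ih1 ih2 => simp only [ksat, kbsat, ih1, ih2]

/-- The strategy profile induced by a valuation of the variables `Q`. -/
def profOfQ {ι P : Type} (owner : P → ι) (w : Set (QVar owner)) : Profile owner := fun i =>
  { reveal := fun j => {p | owner p = i ∧ ∀ h : j ≠ owner p, (⟨(j, p), h⟩ : QVar owner) ∈ w}
    reveal_subset := fun _ _ hp => hp.1
    reveal_self := by
      ext p
      exact ⟨fun h => h.1, fun h => ⟨h, fun hn => absurd (Eq.symm h) hn⟩⟩ }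

theorem etaP_profOfQ {ι P : Type} (owner : P → ι) (w : Set (QVar owner)) :
    etaP owner (profOfQ owner w) = w := by
  ext ⟨⟨j, p⟩, hq⟩
  exact ⟨fun h => h.2 hq, fun h => ⟨rfl, fun _ => h⟩⟩

theorem etaP_update {ι P : Type} [DecidableEq ι] (owner : P → ι) (s t : Profile owner) (i : ι) :
    etaP owner (Function.update s i (t i)) =
      bDeviateQ owner (etaP owner s) i (etaP owner t) := by
  ext ⟨⟨j, p⟩, hq⟩
  change p ∈ (Function.update s i (t i) (owner p)).reveal j ↔
    @ite _ (owner p = i) (Classical.propDecidable _)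
      (p ∈ (t (owner p)).reveal j) (p ∈ (s (owner p)).reveal j)
  by_cases h : owner p = i
  · subst h; simp
  · simp [h]

theorem applyU_update {ι P : Type} [DecidableEq ι] (owner : P → ι) (us : UProfile owner) (i : ι)
    (f : Set P → Strategy owner i) (v : Set P) :
    applyU owner (Function.update us i f) v = Function.update (applyU owner us v) i (f v) := by
  funext k
  by_cases h : k = i
  · subst h; simp [applyU]
  · simp [applyU, h]

theorem outcome_eq_ubq {ι P : Type} (owner : P → ι) (γ : ι → KwForm ι P)
    (hγ : ∀ i, NoTrivial owner (γ i)) (i : ι) (v : Set P) (s : Profile owner) :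
    outcome owner (fun i v s => ksat owner v s (γ i)) i v s = ubq owner γ i (etaP owner s) := by
  simp only [outcome, ubq, ksat_iff_kbsat owner v s _ (hγ i)]

/-- `NE(B_G) ≠ ∅` iff `NE_max(G) ≠ ∅`. -/
theorem NE_BG_iff_NEmax_G {ι P : Type} [Fintype ι] [Fintype P] [DecidableEq ι]
    (owner : P → ι) (γ : ι → KwForm ι P) (hγ : ∀ i, NoTrivial owner (γ i)) :
    (∃ w : Set (QVar owner), BNEQ owner γ w) ↔
      (∃ us : UProfile owner, NEmax owner (fun i v s => ksat owner v s (γ i)) us) := by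
  constructor
  · rintro ⟨w, hw⟩
    refine ⟨fun i _ => profOfQ owner w i, fun i _ _ _ => rfl, ?_⟩
    rintro i f - v ⟨x, -, hx⟩
    rw [outcome_eq_ubq owner γ hγ, outcome_eq_ubq owner γ hγ, applyU_update] at hx
    have h1 : applyU owner (fun i _ => profOfQ owner w i) x = profOfQ owner w := rfl
    have h2 := etaP_update owner (profOfQ owner w)
      (Function.update (profOfQ owner w) i (f x)) i
    rw [Function.update_self] at h2
    rw [h1, h2, etaP_profOfQ] at hx
    exact absurd hx (not_lt.mpr (hw i _))
  · rintro ⟨us, -, hne⟩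
    refine ⟨etaP owner (applyU owner us ∅), fun i wi => ?_⟩
    by_contra hlt
    refine hne i (fun _ => profOfQ owner wi i) (fun _ _ _ => rfl) ∅ ⟨∅, rfl, ?_⟩
    rw [outcome_eq_ubq owner γ hγ, outcome_eq_ubq owner γ hγ, applyU_update, etaP_update,
      etaP_profOfQ]
    exact not_le.mp hlt
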